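/- arXiv:2509.21756 — 2 statements merged into one kernel-verified Lean document; each statement's English description precedes it below -/
import Mathlib

section
/- For every integer $t \ge 2$, $ex_{\chi \le 3}(n, K_{2,t}) = \sqrt{\frac{t-1}{6}}\, n^{3/2} + o(n^{3/2})$ as $n \to \infty$; equivalently, $\lim_{n \to \infty} \frac{ex_{\chi \le 3}(n, K_{2,t})}{n^{3/2}} = \sqrt{\frac{t-1}{6}}$. -/
/-- `exChi3 t n` is `ex_{χ≤3}(n, K_{2,t})`: the maximum number of edges in a
`K_{2,t}`-free graph on `n` vertices with chromatic number at most `3` (i.e. a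
`3`-colorable graph in which every two distinct vertices have at most `t-1` common
neighbours). -/
noncomputable def exChi3 (t n : ℕ) : ℕ :=
  sSup {m | ∃ G : SimpleGraph (Fin n),
    G.Colorable 3 ∧
    (∀ u v, u ≠ v → (G.commonNeighbors u v).ncard ≤ t - 1) ∧
    G.edgeSet.ncard = m}

open MeasureTheory Set Filter Topology

/-- A continuous compactly supported function (a combination of splines) whose cosine transform
is `(4 - u ^ 2) * (sin u / u) ^ 4`. -/
noncomputable def splineKernel (t : ℝ) : ℝ :=
  ((4 - t) ^ 3 - 4 * max (2 - t) 0 ^ 3) / 12 - max (2 - t) 0 / 2 + (4 - t) / 8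

/-- The cosine transform of `splineKernel`. -/
noncomputable def splineTransform (u : ℝ) : ℝ :=
  ∫ t in (0 : ℝ)..4, splineKernel t * Real.cos (u * t)

theorem continuous_splineKernel : Continuous splineKernel := by
  unfold splineKernel; fun_prop

theorem integral_sub_mul_cos (a : ℝ) {u : ℝ} (hu : u ≠ 0) :
    ∫ t in (0 : ℝ)..a, (a - t) * Real.cos (u * t) = (1 - Real.cos (u * a)) / u ^ 2 := by
  have h : ∀ t ∈ uIcc 0 a, HasDerivAt
      (fun t ↦ (a - t) * Real.sin (u * t) / u - Real.cos (u * t) / u ^ 2)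
      ((a - t) * Real.cos (u * t)) t := by
    intro t _
    have h1 : HasDerivAt (fun t : ℝ ↦ u * t) u t := by simpa using (hasDerivAt_id t).const_mul u
    have h2 : HasDerivAt (fun t : ℝ ↦ a - t) (-1) t := by simpa using (hasDerivAt_id t).const_sub a
    convert! ((h2.mul h1.sin).div_const u).sub (h1.cos.div_const (u ^ 2)) using 1
    field_simp
    ring
  rw [intervalIntegral.integral_eq_sub_of_hasDerivAt h
    (Continuous.intervalIntegrable (by fun_prop) _ _)]
  simp
  ring

theorem integral_sub_pow_three_mul_cos (a : ℝ) {u : ℝ} (hu : u ≠ 0) :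
    ∫ t in (0 : ℝ)..a, (a - t) ^ 3 * Real.cos (u * t) =
      3 * a ^ 2 / u ^ 2 - 6 * (1 - Real.cos (u * a)) / u ^ 4 := by
  have h : ∀ t ∈ uIcc 0 a, HasDerivAt
      (fun t ↦ (a - t) ^ 3 * Real.sin (u * t) / u - 3 * (a - t) ^ 2 * Real.cos (u * t) / u ^ 2
        - 6 * (a - t) * Real.sin (u * t) / u ^ 3 + 6 * Real.cos (u * t) / u ^ 4)
      ((a - t) ^ 3 * Real.cos (u * t)) t := by
    intro t _
    have h1 : HasDerivAt (fun t : ℝ ↦ u * t) u t := by simpa using (hasDerivAt_id t).const_mul u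
    have h2 : HasDerivAt (fun t : ℝ ↦ a - t) (-1) t := by simpa using (hasDerivAt_id t).const_sub a
    convert! (((((h2.pow 3).mul h1.sin).div_const u).sub
      ((((h2.pow 2).const_mul 3).mul h1.cos).div_const (u ^ 2))).sub
      (((h2.const_mul 6).mul h1.sin).div_const (u ^ 3))).add
      ((h1.cos.const_mul 6).div_const (u ^ 4)) using 1
    field_simp
    simp
    ring
  rw [intervalIntegral.integral_eq_sub_of_hasDerivAt h
    (Continuous.intervalIntegrable (by fun_prop) _ _)]
  simp
  ring

theorem integral_max_sub_pow_mul_cos (k : ℕ) (hk : k ≠ 0) (u : ℝ) :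
    ∫ t in (0 : ℝ)..4, max (2 - t) 0 ^ k * Real.cos (u * t) =
      ∫ t in (0 : ℝ)..2, (2 - t) ^ k * Real.cos (u * t) := by
  rw [← intervalIntegral.integral_add_adjacent_intervals (b := 2)
    (Continuous.intervalIntegrable (by fun_prop) _ _)
    (Continuous.intervalIntegrable (by fun_prop) _ _)]
  have h1 : ∫ t in (2 : ℝ)..4, max (2 - t) 0 ^ k * Real.cos (u * t) = 0 := by
    rw [intervalIntegral.integral_congr (g := fun _ ↦ 0)]
    · simp
    · intro t ht
      rw [uIcc_of_le (by norm_num)] at ht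
      simp [max_eq_right (sub_nonpos.2 ht.1), hk]
  rw [h1, add_zero]
  refine intervalIntegral.integral_congr fun t ht ↦ ?_
  rw [uIcc_of_le (by norm_num)] at ht
  simp [max_eq_left (sub_nonneg.2 ht.2)]

theorem splineTransform_of_ne_zero {u : ℝ} (hu : u ≠ 0) :
    splineTransform u = (4 - u ^ 2) * (Real.sin u / u) ^ 4 := by
  have e : splineTransform u =
      ((∫ t in (0 : ℝ)..4, (4 - t) ^ 3 * Real.cos (u * t)) -
        4 * ∫ t in (0 : ℝ)..4, max (2 - t) 0 ^ 3 * Real.cos (u * t)) / 12 -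
      (∫ t in (0 : ℝ)..4, max (2 - t) 0 ^ 1 * Real.cos (u * t)) / 2 +
      (∫ t in (0 : ℝ)..4, (4 - t) * Real.cos (u * t)) / 8 := by
    simp only [← intervalIntegral.integral_const_mul, ← intervalIntegral.integral_div]
    rw [← intervalIntegral.integral_sub, ← intervalIntegral.integral_div,
      ← intervalIntegral.integral_sub, ← intervalIntegral.integral_add]
    · refine intervalIntegral.integral_congr fun t _ ↦ ?_
      simp only [splineKernel]
      ring
    all_goals exact Continuous.intervalIntegrable (by fun_prop) _ _
  rw [e, integral_max_sub_pow_mul_cos 3 (by norm_num), integral_max_sub_pow_mul_cos 1 (by norm_num)]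
  simp only [pow_one]
  rw [integral_sub_pow_three_mul_cos _ hu, integral_sub_pow_three_mul_cos _ hu,
    integral_sub_mul_cos _ hu, integral_sub_mul_cos _ hu]
  have h4 : Real.cos (u * 4) = 2 * (1 - 2 * Real.sin u ^ 2) ^ 2 - 1 := by
    rw [show u * 4 = 2 * (2 * u) by ring, Real.cos_two_mul, Real.cos_two_mul, Real.cos_sq']
    ring
  have h2 : Real.cos (u * 2) = 1 - 2 * Real.sin u ^ 2 := by
    rw [mul_comm, Real.cos_two_mul, Real.cos_sq']
    ring
  rw [h4, h2]
  field_simp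
  ring

theorem continuous_splineTransform : Continuous splineTransform := by
  unfold splineTransform
  refine intervalIntegral.continuous_parametric_intervalIntegral_of_continuous' ?_ _ _
  have := continuous_splineKernel
  fun_prop

theorem splineTransform_nonpos {u : ℝ} (hu : 2 ≤ |u|) : splineTransform u ≤ 0 := by
  have h0 : u ≠ 0 := by rintro rfl; norm_num at hu
  rw [splineTransform_of_ne_zero h0]
  refine mul_nonpos_of_nonpos_of_nonneg ?_ (by positivity)
  nlinarith [sq_abs u]

theorem abs_splineTransform_le (u : ℝ) (hu : 1 ≤ |u|) : |splineTransform u| ≤ 4 * (u ^ 2)⁻¹ := by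
  have h0 : u ≠ 0 := by rintro rfl; norm_num at hu
  have h1 : 1 ≤ u ^ 2 := by nlinarith [sq_abs u]
  rw [splineTransform_of_ne_zero h0, abs_mul, div_pow, abs_div,
    abs_of_nonneg (by positivity : 0 ≤ u ^ 4)]
  have h2 : |Real.sin u ^ 4| ≤ 1 := by
    rw [abs_pow]; exact pow_le_one₀ (abs_nonneg _) (Real.abs_sin_le_one u)
  have h3 : |4 - u ^ 2| ≤ 4 * u ^ 2 := by rw [abs_le]; constructor <;> nlinarith
  calc _ ≤ 4 * u ^ 2 * (1 / u ^ 4) := by gcongr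
    _ = _ := by field_simp

theorem exists_abs_splineTransform_le : ∃ C, ∀ u, |splineTransform u| ≤ C * (1 + u ^ 2)⁻¹ := by
  obtain ⟨C, hC⟩ := isCompact_Icc.exists_bound_of_continuousOn (s := Icc (-1 : ℝ) 1)
    continuous_splineTransform.continuousOn
  refine ⟨max (2 * C) 8, fun u ↦ ?_⟩
  rw [← div_eq_mul_inv, le_div_iff₀ (by positivity)]
  rcases le_total |u| 1 with h | h
  · have h1 := hC u (abs_le.1 h)
    rw [Real.norm_eq_abs] at h1
    refine le_trans ?_ (le_max_left _ _)
    have : u ^ 2 ≤ 1 := by nlinarith [sq_abs u, abs_nonneg u]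
    nlinarith [abs_nonneg (splineTransform u)]
  · refine le_trans ?_ (le_max_right _ _)
    have h1 := abs_splineTransform_le u h
    have h2 : 1 ≤ u ^ 2 := by nlinarith [sq_abs u]
    rw [← div_eq_mul_inv, le_div_iff₀ (by positivity)] at h1
    nlinarith [abs_nonneg (splineTransform u)]

theorem integrable_splineTransform : Integrable splineTransform := by
  obtain ⟨C, hC⟩ := exists_abs_splineTransform_le
  exact (integrable_inv_one_add_sq.const_mul C).mono'
    continuous_splineTransform.aestronglyMeasurable (.of_forall hC)

theorem integral_splineTransform_pos : 0 < ∫ u, splineTransform u := by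
  have heven : ∀ u, splineTransform |u| = splineTransform u := fun u ↦ by
    rcases abs_choice u with h | h <;> simp [h, splineTransform]
  have hI := integrable_splineTransform
  have h1 : (9 / 10 : ℝ) ≤ ∫ u in Ioc (0 : ℝ) 1, splineTransform u := by
    have : ∫ u in Ioc (0 : ℝ) 1, (9 / 10 : ℝ) = 9 / 10 := by simp
    rw [← this]
    refine setIntegral_mono_on (by simp) hI.integrableOn measurableSet_Ioc fun u hu ↦ ?_
    rw [splineTransform_of_ne_zero hu.1.ne']
    have h2 : 3 / 4 ≤ Real.sin u / u := by
      rw [le_div_iff₀ hu.1]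
      have := Real.sin_gt_sub_cube hu.1
      nlinarith [hu.1, hu.2, mul_pos hu.1 hu.1]
    have h3 : 3 ≤ 4 - u ^ 2 := by nlinarith [hu.1, hu.2]
    calc (9 / 10 : ℝ) ≤ 3 * (3 / 4) ^ 4 := by norm_num
      _ ≤ _ := by gcongr
  have h2 : 0 ≤ ∫ u in Ioc (1 : ℝ) 2, splineTransform u := by
    refine setIntegral_nonneg measurableSet_Ioc fun u hu ↦ ?_
    rw [splineTransform_of_ne_zero (by linarith [hu.1])]
    exact mul_nonneg (by nlinarith [hu.1, hu.2]) (by positivity)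
  have h3 : -(1 / 2 : ℝ) ≤ ∫ u in Ioi (2 : ℝ), splineTransform u := by
    have : ∫ u in Ioi (2 : ℝ), -(u ^ (-2 : ℝ)) = -(1 / 2) := by
      rw [integral_neg, integral_Ioi_rpow_of_lt (by norm_num) (by norm_num)]
      norm_num [Real.rpow_neg_one]
    rw [← this]
    refine setIntegral_mono_on
      (integrableOn_Ioi_rpow_of_lt (by norm_num) (by norm_num)).neg hI.integrableOn
      measurableSet_Ioi fun u hu ↦ ?_
    have hu : 2 < u := hu
    have h0 : 0 < u := by linarith
    rw [splineTransform_of_ne_zero h0.ne', Real.rpow_neg h0.le, Real.rpow_two, div_pow]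
    have h4 : Real.sin u ^ 4 ≤ 1 := by
      rw [← Even.pow_abs (by decide : Even 4)]
      exact pow_le_one₀ (abs_nonneg _) (Real.abs_sin_le_one u)
    have h5 : (u ^ 2 - 4) * (Real.sin u ^ 4 / u ^ 4) ≤ u ^ 2 * (1 / u ^ 4) := by
      gcongr
      linarith
    have h6 : u ^ 2 * (1 / u ^ 4) = (u ^ 2)⁻¹ := by field_simp
    linarith
  have e : ∫ u, splineTransform u = 2 * ∫ u in Ioi (0 : ℝ), splineTransform u := by
    rw [← integral_comp_abs]
    simp [heven]
  have hu1 : Ioi (0 : ℝ) = Ioc 0 1 ∪ (Ioc 1 2 ∪ Ioi 2) := by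
    rw [Ioc_union_Ioi_eq_Ioi (by norm_num), Ioc_union_Ioi_eq_Ioi (by norm_num)]
  rw [e, hu1, setIntegral_union, setIntegral_union]
  · linarith
  · exact Set.disjoint_left.2 fun x hx hx' ↦ (hx.2.trans_lt hx').false
  · exact measurableSet_Ioi
  · exact hI.integrableOn
  · exact hI.integrableOn
  · rw [Ioc_union_Ioi_eq_Ioi (by norm_num)]
    exact Set.disjoint_left.2 fun x hx hx' ↦ (hx.2.trans_lt hx').false
  · exact measurableSet_Ioc.union measurableSet_Ioi
  · exact hI.integrableOn
  · exact hI.integrableOn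

theorem re_cexp_mul_term (f : ℕ → ℝ) {n : ℕ} (hn : n ≠ 0) (σ y X : ℝ) :
    (Complex.exp (Complex.I * (y * X : ℝ)) *
      LSeries.term (fun n ↦ (f n : ℂ)) (σ + Complex.I * y) n).re =
      f n / (n : ℝ) ^ σ * Real.cos (y * (Real.log n - X)) := by
  have hn' : (n : ℂ) ≠ 0 := by exact_mod_cast hn
  have hpos : (0 : ℝ) < n := by positivity
  rw [LSeries.term_of_ne_zero hn, Complex.cpow_add _ _ hn']
  have h1 : (n : ℂ) ^ (σ : ℂ) = ((n : ℝ) ^ σ : ℝ) := by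
    rw [Complex.ofReal_cpow hpos.le]; simp
  have h2 : (n : ℂ) ^ (Complex.I * (y : ℂ)) = Complex.exp (Complex.I * (y * Real.log n : ℝ)) := by
    rw [Complex.cpow_def_of_ne_zero hn', ← Complex.natCast_log]
    congr 1
    push_cast
    ring
  rw [h1, h2]
  have h3 : Complex.exp (Complex.I * (y * X : ℝ)) * ((f n : ℂ) / ((((n : ℝ) ^ σ : ℝ) : ℂ) *
      Complex.exp (Complex.I * (y * Real.log n : ℝ)))) =
      ((f n / (n : ℝ) ^ σ : ℝ) : ℂ) *
        Complex.exp (((-(y * (Real.log n - X)) : ℝ) : ℂ) * Complex.I) := by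
    rw [show ((-(y * (Real.log n - X)) : ℝ) : ℂ) * Complex.I =
      Complex.I * (y * X : ℝ) - Complex.I * (y * Real.log n : ℝ) by push_cast; ring,
      Complex.exp_sub]
    push_cast
    field_simp
  rw [h3, Complex.re_ofReal_mul, Complex.exp_ofReal_mul_I_re, Real.cos_neg]

theorem tsum_mul_splineTransform {f : ℕ → ℝ} {σ : ℝ} (hσ : σ ≠ 0)
    (hf : LSeriesSummable (fun n ↦ (f n : ℂ)) σ) (T X : ℝ) :
    ∑' n : ℕ, f n / (n : ℝ) ^ σ * splineTransform (T * (Real.log n - X)) =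
      ∫ t in (0 : ℝ)..4, splineKernel t * (Complex.exp (Complex.I * (T * t * X : ℝ)) *
        LSeries (fun n ↦ (f n : ℂ)) (σ + Complex.I * (T * t : ℝ))).re := by
  have hk := continuous_splineKernel
  obtain ⟨C, hC⟩ := isCompact_Icc.exists_bound_of_continuousOn (s := Icc (0 : ℝ) 4)
    hk.continuousOn
  have hterm : ∀ n : ℕ, f n / (n : ℝ) ^ σ * splineTransform (T * (Real.log n - X)) =
      ∫ t in Ioc (0 : ℝ) 4, splineKernel t * (Complex.exp (Complex.I * (T * t * X : ℝ)) *
        LSeries.term (fun n ↦ (f n : ℂ)) (σ + Complex.I * (T * t : ℝ)) n).re := by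
    intro n
    rcases eq_or_ne n 0 with rfl | hn
    · simp [Real.zero_rpow hσ]
    · simp only [re_cexp_mul_term f hn, splineTransform]
      rw [← intervalIntegral.integral_const_mul, intervalIntegral.integral_of_le (by norm_num)]
      refine integral_congr_ae (.of_forall fun t ↦ ?_)
      simp only
      rw [show T * t * (Real.log n - X) = T * (Real.log n - X) * t by ring]
      ring
  have hs : ∀ t : ℝ, LSeriesSummable (fun n ↦ (f n : ℂ)) (σ + Complex.I * (T * t : ℝ)) :=
    fun t ↦ hf.of_re_le_re (by simp)
  have hre : ∀ t : ℝ, splineKernel t * (Complex.exp (Complex.I * (T * t * X : ℝ)) *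
        LSeries (fun n ↦ (f n : ℂ)) (σ + Complex.I * (T * t : ℝ))).re =
      ∑' n, splineKernel t * (Complex.exp (Complex.I * (T * t * X : ℝ)) *
        LSeries.term (fun n ↦ (f n : ℂ)) (σ + Complex.I * (T * t : ℝ)) n).re := by
    intro t
    rw [tsum_mul_left, LSeries, ← tsum_mul_left, Complex.re_tsum ((hs t).mul_left _)]
  have hnorm : ∀ (n : ℕ) (t : ℝ), t ∈ Icc (0 : ℝ) 4 →
      ‖splineKernel t * (Complex.exp (Complex.I * (T * t * X : ℝ)) *
        LSeries.term (fun n ↦ (f n : ℂ)) (σ + Complex.I * (T * t : ℝ)) n).re‖ ≤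
      C * ‖LSeries.term (fun n ↦ (f n : ℂ)) σ n‖ := by
    intro n t ht
    rw [norm_mul]
    refine mul_le_mul (hC t ht) ?_ (norm_nonneg _) ((norm_nonneg _).trans (hC t ht))
    rw [Real.norm_eq_abs]
    refine (Complex.abs_re_le_norm _).trans ?_
    rw [norm_mul, mul_comm Complex.I, Complex.norm_exp_ofReal_mul_I, one_mul]
    exact LSeries.norm_term_le_of_re_le_re _ (by simp) n
  have hcont : ∀ n : ℕ, Continuous fun t : ℝ ↦
      splineKernel t * (Complex.exp (Complex.I * (T * t * X : ℝ)) *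
        LSeries.term (fun n ↦ (f n : ℂ)) (σ + Complex.I * (T * t : ℝ)) n).re := by
    intro n
    rcases eq_or_ne n 0 with rfl | hn
    · simpa using continuous_const
    · simp only [re_cexp_mul_term f hn]
      fun_prop
  simp only [hre, hterm, intervalIntegral.integral_of_le (show (0 : ℝ) ≤ 4 by norm_num)]
  refine (hasSum_integral_of_dominated_convergence
    (fun n _ ↦ C * ‖LSeries.term (fun n ↦ (f n : ℂ)) σ n‖)
    (fun n ↦ (hcont n).aestronglyMeasurable) ?_ ?_ ?_ ?_).tsum_eq
  · exact fun n ↦ (ae_restrict_iff' measurableSet_Ioc).2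
      (.of_forall fun t ht ↦ hnorm n t (Ioc_subset_Icc_self ht))
  · exact .of_forall fun t ↦ (hf.norm.mul_left C)
  · simp
  · refine (ae_restrict_iff' measurableSet_Ioc).2 (.of_forall fun t ht ↦ ?_)
    exact (Summable.of_norm_bounded (hf.norm.mul_left C)
      (fun n ↦ hnorm n t (Ioc_subset_Icc_self ht))).hasSum

theorem integral_exp_mul_splineTransform {ε : ℝ} (hε : 0 < ε) (T X : ℝ) :
    ∫ v in Ioi (0 : ℝ), Real.exp (-ε * v) * splineTransform (T * (v - X)) =
      ∫ t in (0 : ℝ)..4, splineKernel t * (Complex.exp (Complex.I * (T * t * X : ℝ)) *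
        (1 / (ε + Complex.I * (T * t : ℝ)))).re := by
  have hk := continuous_splineKernel
  have hIntOn : ∀ t : ℝ, IntegrableOn
      (fun v : ℝ ↦ Complex.exp (Complex.I * (T * t * X : ℝ)) *
        Complex.exp (-(ε + Complex.I * (T * t : ℝ)) * v)) (Ioi 0) := fun t ↦
    (integrableOn_exp_mul_complex_Ioi (by simpa using hε) 0).const_mul _
  have hpt : ∀ t v : ℝ, (Complex.exp (Complex.I * (T * t * X : ℝ)) *
        Complex.exp (-(ε + Complex.I * (T * t : ℝ)) * v)).re =
      Real.exp (-ε * v) * Real.cos (T * (v - X) * t) := by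
    intro t v
    rw [← Complex.exp_add, show Complex.I * (T * t * X : ℝ) + -(ε + Complex.I * (T * t : ℝ)) * v =
      ((-ε * v : ℝ) : ℂ) + ((-(T * (v - X) * t) : ℝ) : ℂ) * Complex.I by push_cast; ring,
      Complex.exp_add, ← Complex.ofReal_exp, Complex.re_ofReal_mul, Complex.exp_ofReal_mul_I_re,
      Real.cos_neg]
  have h1 : ∀ t : ℝ, (Complex.exp (Complex.I * (T * t * X : ℝ)) *
        (1 / (ε + Complex.I * (T * t : ℝ)))).re =
      ∫ v in Ioi (0 : ℝ), Real.exp (-ε * v) * Real.cos (T * (v - X) * t) := by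
    intro t
    simp only [← hpt]
    have := integral_re (hIntOn t)
    simp only [RCLike.re_to_complex] at this
    rw [this, integral_const_mul, integral_exp_mul_complex_Ioi (by simpa using hε),
      Complex.ofReal_zero, mul_zero, Complex.exp_zero, neg_div_neg_eq]
  simp only [h1, intervalIntegral.integral_of_le (show (0 : ℝ) ≤ 4 by norm_num), splineTransform,
    ← integral_const_mul]
  rw [integral_integral_swap]
  · refine integral_congr_ae (.of_forall fun t ↦ integral_congr_ae (.of_forall fun v ↦ ?_))
    simp only
    ring
  · have h2 : Integrable (fun v : ℝ ↦ Real.exp (-ε * v)) (volume.restrict (Ioi 0)) :=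
      integrableOn_exp_mul_Ioi (by linarith) 0
    have h3 : Integrable splineKernel (volume.restrict (Ioc 0 4)) :=
      hk.integrableOn_Ioc
    refine (h2.mul_prod h3).mono (Continuous.aestronglyMeasurable (by fun_prop)) (.of_forall ?_)
    rintro ⟨v, t⟩
    simp only [Function.uncurry, norm_mul]
    have := Real.abs_cos_le_one (T * (v - X) * t)
    rw [← mul_assoc]
    exact mul_le_of_le_one_right (by positivity) this

theorem tendsto_integral_exp_mul_splineTransform {T : ℝ} (hT : 0 < T) (X : ℝ) :
    Tendsto (fun ε : ℝ ↦ ∫ v in Ioi (0 : ℝ), Real.exp (-ε * v) * splineTransform (T * (v - X)))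
      (𝓝[>] 0) (𝓝 (∫ v in Ioi (0 : ℝ), splineTransform (T * (v - X)))) := by
  have hc := continuous_splineTransform
  have hI : Integrable fun v ↦ splineTransform (T * (v - X)) :=
    (integrable_splineTransform.comp_mul_left' hT.ne').comp_sub_right X
  refine tendsto_integral_filter_of_dominated_convergence
    (fun v ↦ ‖splineTransform (T * (v - X))‖) (.of_forall fun ε ↦
      Continuous.aestronglyMeasurable (by fun_prop)) ?_ hI.norm.integrableOn ?_
  · filter_upwards [self_mem_nhdsWithin] with ε hε
    refine (ae_restrict_iff' measurableSet_Ioi).2 (.of_forall fun v hv ↦ ?_)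
    rw [norm_mul, Real.norm_eq_abs, Real.abs_exp]
    refine mul_le_of_le_one_left (norm_nonneg _) (Real.exp_le_one_iff.2 ?_)
    have := mul_pos (show 0 < ε from hε) (show 0 < v from hv)
    linarith
  · refine .of_forall fun v ↦ ?_
    have : Continuous fun ε : ℝ ↦ Real.exp (-ε * v) * splineTransform (T * (v - X)) := by fun_prop
    simpa using (this.tendsto 0).mono_left nhdsWithin_le_nhds

theorem le_integral_Ioi_splineTransform {T X : ℝ} (hT : 0 < T) (hX : 2 ≤ T * X) :
    T⁻¹ * ∫ u, splineTransform u ≤ ∫ v in Ioi (0 : ℝ), splineTransform (T * (v - X)) := by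
  have hI : Integrable fun v ↦ splineTransform (T * (v - X)) :=
    (integrable_splineTransform.comp_mul_left' hT.ne').comp_sub_right X
  have h1 : ∫ v, splineTransform (T * (v - X)) = T⁻¹ * ∫ u, splineTransform u := by
    rw [integral_sub_right_eq_self (fun v ↦ splineTransform (T * v)) X,
      Measure.integral_comp_mul_left, abs_of_pos (inv_pos.2 hT), smul_eq_mul]
  rw [← h1, ← integral_add_compl measurableSet_Ioi hI, compl_Ioi]
  have h2 : ∫ v in Iic (0 : ℝ), splineTransform (T * (v - X)) ≤ 0 := by
    refine setIntegral_nonpos measurableSet_Iic fun v hv ↦ splineTransform_nonpos ?_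
    have : T * v ≤ 0 := mul_nonpos_of_nonneg_of_nonpos hT.le hv
    rw [abs_of_nonpos (by nlinarith)]
    nlinarith
  linarith

theorem tendsto_integral_re_cexp_mul {g : ℝ → ℂ} (hg : Continuous g) {T : ℝ} (hT : 0 < T) :
    Tendsto (fun X : ℝ ↦ ∫ t in (0 : ℝ)..4, splineKernel t *
      (Complex.exp (Complex.I * (T * t * X : ℝ)) * g t).re) atTop (𝓝 0) := by
  have hk := continuous_splineKernel
  have hRL := Real.tendsto_integral_exp_smul_cocompact
    ((Ioc (0 : ℝ) 4).indicator fun t ↦ (splineKernel t : ℂ) * g t)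
  have hlim : Tendsto (fun X : ℝ ↦ -(T / (2 * Real.pi) * X)) atTop (cocompact ℝ) := by
    rw [cocompact_eq_atBot_atTop]
    exact (tendsto_neg_atTop_atBot.comp
      (tendsto_id.const_mul_atTop (by positivity))).mono_right le_sup_left
  have h := (Complex.continuous_re.tendsto 0).comp (hRL.comp hlim)
  rw [Complex.zero_re] at h
  refine h.congr fun X ↦ ?_
  simp only [Function.comp_apply]
  have e : ∀ t : ℝ, (Real.fourierChar (-(t * -(T / (2 * Real.pi) * X)))) •
      (Ioc (0 : ℝ) 4).indicator (fun t ↦ (splineKernel t : ℂ) * g t) t =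
      (Ioc (0 : ℝ) 4).indicator (fun t ↦ (splineKernel t : ℂ) *
        (Complex.exp (Complex.I * (T * t * X : ℝ)) * g t)) t := by
    intro t
    by_cases ht : t ∈ Ioc (0 : ℝ) 4
    · rw [indicator_of_mem ht, indicator_of_mem ht, Circle.smul_def, Real.fourierChar_apply,
        smul_eq_mul, show 2 * Real.pi * -(t * -(T / (2 * Real.pi) * X)) = T * t * X by
          field_simp, mul_comm Complex.I]
      ring
    · simp [ht]
  simp only [e]
  rw [integral_indicator measurableSet_Ioc, intervalIntegral.integral_of_le (by norm_num)]
  have hIntOn : IntegrableOn (fun t : ℝ ↦ (splineKernel t : ℂ) *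
        (Complex.exp (Complex.I * (T * t * X : ℝ)) * g t)) (Ioc 0 4) :=
    Continuous.integrableOn_Ioc (by fun_prop)
  have := integral_re hIntOn
  simp only [RCLike.re_to_complex, Complex.re_ofReal_mul] at this
  exact this.symm

open ArithmeticFunction.vonMangoldt in
/-- For every modulus `N`, multiplicatively short intervals contain a prime power that is
congruent to `1` modulo `N`. -/
theorem eventually_exists_isPrimePow_abs_log_sub_lt (N : ℕ) [NeZero N] {η : ℝ} (hη : 0 < η) :
    ∀ᶠ X : ℝ in atTop, ∃ n : ℕ, IsPrimePow n ∧ (n : ZMod N) = 1 ∧ |Real.log n - X| < η := by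
  set T := 2 / η with hTdef
  have hT : 0 < T := by positivity
  set c : ℝ := (N.totient : ℝ)⁻¹ with hc
  have hcpos : 0 < c := inv_pos.2 (by exact_mod_cast Nat.totient_pos.2 (NeZero.pos N))
  obtain ⟨h, hh⟩ : ∃ h : ℂ → ℂ, h = LFunctionResidueClassAux (1 : ZMod N) := ⟨_, rfl⟩
  have hcont : ContinuousOn h {s | 1 ≤ s.re} :=
    hh ▸ continuousOn_LFunctionResidueClassAux 1
  have hcont2 : Continuous fun p : ℝ × ℝ ↦
      h ((max p.1 1 : ℝ) + Complex.I * (T * p.2 : ℝ)) := by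
    refine hcont.comp_continuous (by fun_prop) fun p ↦ ?_
    simp
  have hk := continuous_splineKernel
  have hg : Continuous fun t : ℝ ↦ h (1 + Complex.I * (T * t : ℝ)) := by
    have := hcont2.comp (Continuous.prodMk_right (1 : ℝ))
    simpa [Function.comp_def] using this
  have hR := tendsto_integral_re_cexp_mul hg hT
  have hpos : 0 < c * (T⁻¹ * ∫ u, splineTransform u) :=
    mul_pos hcpos (mul_pos (inv_pos.2 hT) integral_splineTransform_pos)
  filter_upwards [hR.eventually (lt_mem_nhds (neg_lt_zero.2 hpos)),
    eventually_ge_atTop (2 / T)] with X hX1 hX2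
  by_contra! hno
  have hX3 : 2 ≤ T * X := by rwa [div_le_iff₀' hT] at hX2
  have hsum : ∀ ε : ℝ, 0 < ε →
      c * (∫ v in Ioi (0 : ℝ), Real.exp (-ε * v) * splineTransform (T * (v - X))) +
      ∫ t in (0 : ℝ)..4, splineKernel t * (Complex.exp (Complex.I * (T * t * X : ℝ)) *
        h ((max (1 + ε) 1 : ℝ) + Complex.I * (T * t : ℝ))).re ≤ 0 := by
    intro ε hε
    have hsumm : LSeriesSummable (fun n ↦ (residueClass (1 : ZMod N) n : ℂ)) (1 + ε : ℝ) := by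
      refine LSeriesSummable_of_abscissaOfAbsConv_lt_re
        ((abscissaOfAbsConv_residueClass_le_one (1 : ZMod N)).trans_lt ?_)
      rw [Complex.ofReal_re]
      exact_mod_cast (by linarith : (1 : ℝ) < 1 + ε)
    have hle : ∑' n : ℕ, residueClass (1 : ZMod N) n / (n : ℝ) ^ (1 + ε) *
        splineTransform (T * (Real.log n - X)) ≤ 0 := by
      refine tsum_nonpos fun n ↦ ?_
      by_cases hn : IsPrimePow n ∧ (n : ZMod N) = 1
      · refine mul_nonpos_of_nonneg_of_nonpos
          (div_nonneg (residueClass_nonneg _ _) (by positivity)) (splineTransform_nonpos ?_)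
        have := hno n hn.1 hn.2
        rw [abs_mul, abs_of_pos hT, hTdef, div_mul_eq_mul_div, le_div_iff₀ hη]
        linarith
      · have : residueClass (1 : ZMod N) n = 0 := by
          rw [residueClass, indicator_apply_eq_zero]
          intro h1
          exact ArithmeticFunction.vonMangoldt_eq_zero_iff.2 fun h2 ↦ hn ⟨h2, h1⟩
        simp [this]
    rw [tsum_mul_splineTransform (by linarith) hsumm] at hle
    rw [max_eq_left (by linarith), integral_exp_mul_splineTransform hε,
      ← intervalIntegral.integral_const_mul, ← intervalIntegral.integral_add]
    · convert hle using 1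
      refine intervalIntegral.integral_congr fun t _ ↦ ?_
      have hs : ((1 + ε : ℝ) + Complex.I * (T * t : ℝ) : ℂ) ∈ {s : ℂ | 1 < s.re} := by
        simp [hε]
      have := eqOn_LFunctionResidueClassAux (a := (1 : ZMod N)) isUnit_one hs
      simp only at this
      simp only [hh, this]
      have e : ((1 + ε : ℝ) + Complex.I * (T * t : ℝ) : ℂ) - 1 = ε + Complex.I * (T * t : ℝ) := by
        push_cast; ring
      rw [e, mul_sub, Complex.sub_re, div_eq_mul_one_div ((N.totient : ℂ)⁻¹),
        mul_left_comm _ ((N.totient : ℂ)⁻¹),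
        show ((N.totient : ℂ)⁻¹) = ((c : ℝ) : ℂ) by simp [hc], Complex.re_ofReal_mul]
      ring
    · refine Continuous.intervalIntegrable ?_ _ _
      have : Continuous fun t : ℝ ↦ (1 / (ε + Complex.I * (T * t : ℝ)) : ℂ) := by
        refine Continuous.div₀ continuous_const (by fun_prop) fun t h0 ↦ ?_
        have := congrArg Complex.re h0
        simp at this
        exact hε.ne' this
      fun_prop
    · refine Continuous.intervalIntegrable ?_ _ _
      have : Continuous fun t : ℝ ↦ h ((1 + ε : ℝ) + Complex.I * (T * t : ℝ)) := by
        refine hcont.comp_continuous (by fun_prop) fun p ↦ ?_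
        simp [hε.le]
      exact hk.mul (Complex.continuous_re.comp (Continuous.mul (by fun_prop) this))
  have hlim1 := (tendsto_integral_exp_mul_splineTransform hT X).const_mul c
  have hlim2 : Tendsto (fun ε : ℝ ↦ ∫ t in (0 : ℝ)..4, splineKernel t *
      (Complex.exp (Complex.I * (T * t * X : ℝ)) *
        h ((max (1 + ε) 1 : ℝ) + Complex.I * (T * t : ℝ))).re) (𝓝[>] 0)
      (𝓝 (∫ t in (0 : ℝ)..4, splineKernel t * (Complex.exp (Complex.I * (T * t * X : ℝ)) *
        h (1 + Complex.I * (T * t : ℝ))).re)) := by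
    have hc3 : Continuous fun ε : ℝ ↦ ∫ t in (0 : ℝ)..4, splineKernel t *
        (Complex.exp (Complex.I * (T * t * X : ℝ)) *
          h ((max (1 + ε) 1 : ℝ) + Complex.I * (T * t : ℝ))).re := by
      refine intervalIntegral.continuous_parametric_intervalIntegral_of_continuous' ?_ _ _
      have := hcont2.comp (f := fun p : ℝ × ℝ ↦ ((1 + p.1, p.2) : ℝ × ℝ)) (by fun_prop)
      simp only [Function.comp_def] at this
      exact (hk.comp continuous_snd).mul
        (Complex.continuous_re.comp (Continuous.mul (by fun_prop) this))
    simpa using (hc3.tendsto 0).mono_left nhdsWithin_le_nhds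
  have hfin := le_of_tendsto (hlim1.add hlim2)
    (by filter_upwards [self_mem_nhdsWithin] with ε hε using hsum ε hε)
  have := mul_le_mul_of_nonneg_left (le_integral_Ioi_splineTransform hT hX3) hcpos.le
  linarith

/-- A finite cover `π : V → Fin n`, with fibers of size at most `s`, of a graph without
four-cycles, oriented along a `3`-colouring by `R`, yields a `3`-colorable graph on `Fin n` in
which codegrees are at most `s` and which loses few edges. -/
theorem exists_simpleGraph_of_cover {V : Type*} [Fintype V] {n s : ℕ} (R : V → V → Prop)
    [DecidableRel R] (c : V → ZMod 3) (hc : ∀ u v, R u v → c v = c u + 1)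
    (huniq : ∀ u v x y, u ≠ v → (R u x ∨ R x u) → (R v x ∨ R x v) → (R u y ∨ R y u) →
      (R v y ∨ R y v) → x = y)
    (π : V → Fin n) (hπ : ∀ u v, π u = π v → c u = c v)
    (hlift : ∀ x y x', (R x y ∨ R y x) → π x' = π x → ∃ y', π y' = π y ∧ (R x' y' ∨ R y' x'))
    (hfib : ∀ a, (Finset.univ.filter fun x ↦ π x = a).card ≤ s) :
    ∃ G : SimpleGraph (Fin n), G.Colorable 3 ∧
      (∀ u v, u ≠ v → (G.commonNeighbors u v).ncard ≤ s) ∧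
      (Finset.univ.filter fun p : V × V ↦ R p.1 p.2).card ≤
        s * G.edgeSet.ncard + s * Fintype.card V := by
  classical
  have hcne : ∀ a : ZMod 3, a ≠ a + 1 := by decide
  have hne : ∀ x y, (R x y ∨ R y x) → π x ≠ π y := by
    rintro x y (h | h) he
    · exact hcne _ ((hπ x y he).trans (hc _ _ h))
    · exact hcne _ ((hπ x y he).symm.trans (hc _ _ h))
  let G : SimpleGraph (Fin n) :=
    { Adj := fun a b ↦ ∃ x y, π x = a ∧ π y = b ∧ (R x y ∨ R y x)
      symm := ⟨fun a b ⟨x, y, hx, hy, h⟩ ↦ ⟨y, x, hy, hx, h.symm⟩⟩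
      loopless := ⟨fun a ⟨x, y, hx, hy, h⟩ ↦ hne x y h (hx.trans hy.symm)⟩ }
  have hG : ∀ a b, G.Adj a b ↔ ∃ x y, π x = a ∧ π y = b ∧ (R x y ∨ R y x) := fun _ _ ↦ Iff.rfl
  have hGlift : ∀ x b, G.Adj (π x) b → ∃ y, π y = b ∧ (R x y ∨ R y x) := by
    rintro x b ⟨x', y', hx', rfl, h⟩
    exact hlift x' y' x h hx'.symm
  refine ⟨G, ?_, ?_, ?_⟩
  · let col : Fin n → ZMod 3 := fun a ↦ if h : ∃ x, π x = a then c h.choose else 0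
    have hcol : ∀ x, col (π x) = c x := by
      intro x
      have h : ∃ y, π y = π x := ⟨x, rfl⟩
      simp only [col, dif_pos h]
      exact hπ _ _ h.choose_spec
    have C : G.Coloring (ZMod 3) := SimpleGraph.Coloring.mk col (by
      rintro a b ⟨x, y, rfl, rfl, h⟩
      rw [hcol, hcol]
      rcases h with h | h <;> rw [hc _ _ h]
      · exact hcne _
      · exact (hcne _).symm)
    simpa using C.colorable
  · intro u v huv
    by_cases hu : ∃ x, π x = u
    swap
    · have : G.commonNeighbors u v = ∅ := by
        ext w
        simp only [SimpleGraph.mem_commonNeighbors, Set.mem_empty_iff_false, iff_false]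
        rintro ⟨⟨x, y, hx, -⟩, -⟩
        exact hu ⟨x, hx⟩
      simp [this]
    obtain ⟨x, rfl⟩ := hu
    have key : ∀ w ∈ G.commonNeighbors (π x) v, ∃ y x', π y = w ∧ (R x y ∨ R y x) ∧ π x' = v ∧
        (R x' y ∨ R y x') := by
      rintro w ⟨h1, h2⟩
      obtain ⟨y, rfl, hy⟩ := hGlift x w h1
      obtain ⟨x', rfl, hx'⟩ := hGlift y v (SimpleGraph.Adj.symm h2)
      exact ⟨y, x', rfl, hy, rfl, hx'.symm⟩
    have : Nonempty V := ⟨x⟩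
    choose! Y X' hYw hxY hX'v hX'Y using key
    have hle := Set.ncard_le_ncard_of_injOn (t := {x' | π x' = v}) X' hX'v
      (fun w hw w' hw' he ↦ by
        rw [← hYw w hw, ← hYw w' hw']
        refine congrArg π (huniq x (X' w) _ _ ?_ (hxY w hw) (hX'Y w hw) (hxY w' hw')
          (he ▸ hX'Y w' hw'))
        rintro h
        exact huv (by rw [← hX'v w hw, ← h]))
    refine hle.trans ?_
    rw [Set.ncard_eq_toFinset_card']
    simpa using hfib v
  · set P := Finset.univ.filter fun p : V × V ↦ R p.1 p.2 with hP
    let good : V × V → Prop := fun p ↦ ∀ y', π y' = π p.2 → R p.1 y' → y' = p.2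
    rw [← Finset.card_filter_add_card_filter_not (s := P) good]
    refine add_le_add ?_ ?_
    · rw [Set.ncard_eq_toFinset_card']
      refine Finset.card_le_mul_card_image_of_maps_to (f := fun p ↦ s(π p.1, π p.2)) ?_ s ?_
      · intro p hp
        simp only [hP, Finset.mem_filter, Finset.mem_univ, true_and] at hp
        rw [Set.mem_toFinset, SimpleGraph.mem_edgeSet, hG]
        exact ⟨_, _, rfl, rfl, .inl hp.1⟩
      · intro e _
        rcases Finset.eq_empty_or_nonempty
          (((P.filter good).filter fun p ↦ s(π p.1, π p.2) = e)) with h0 | ⟨p₀, hp₀⟩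
        · simp [h0]
        have hfst : ∀ p ∈ (P.filter good).filter fun p ↦ s(π p.1, π p.2) = e,
            π p.1 = π p₀.1 ∧ π p.2 = π p₀.2 := by
          intro p hp
          simp only [hP, Finset.mem_filter, Finset.mem_univ, true_and] at hp hp₀
          have he := hp.2.trans hp₀.2.symm
          rcases Sym2.eq_iff.1 he with h | ⟨h1, h2⟩
          · exact h
          · exfalso
            have e1 := hπ _ _ h1
            have e2 := hπ _ _ h2
            rw [hc _ _ hp₀.1.1] at e1
            rw [hc _ _ hp.1.1, e1] at e2
            have : ∀ a : ZMod 3, a + 1 + 1 ≠ a := by decide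
            exact this _ e2
        refine le_trans ?_ (hfib (π p₀.1))
        refine Finset.card_le_card_of_injOn Prod.fst ?_ ?_
        · intro p hp
          simpa using (hfst p hp).1
        · intro p hp p' hp' he
          have h1 := hfst p hp
          have h2 := hfst p' hp'
          simp only [hP, Finset.coe_filter, Finset.mem_filter, Finset.mem_univ, true_and,
            Set.mem_ofPred_eq] at hp hp'
          refine Prod.ext he ?_
          exact (hp.1.2 p'.2 (h2.2.trans h1.2.symm) (by rw [he]; exact hp'.1.1)).symm
    · have hbad : ∀ p ∈ P.filter fun p ↦ ¬ good p, ∃ y', π y' = π p.2 ∧ R p.1 y' ∧ y' ≠ p.2 := by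
        intro p hp
        have := (Finset.mem_filter.1 hp).2
        simpa [good] using this
      rcases isEmpty_or_nonempty V with hV | hV
      · simp [hP]
      choose! Y hY using hbad
      have hle : (P.filter fun p ↦ ¬ good p).card ≤
          (Finset.univ.sigma fun y : V ↦ Finset.univ.filter fun y' ↦ π y' = π y).card := by
        refine Finset.card_le_card_of_injOn (fun p ↦ ⟨p.2, Y p⟩) ?_ ?_
        · intro p hp
          simpa using (hY p hp).1
        · intro p hp p' hp' he
          simp only [Sigma.mk.injEq, heq_eq_eq] at he
          obtain ⟨-, h1, h2⟩ := hY p hp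
          obtain ⟨-, h1', -⟩ := hY p' hp'
          have hR : R p.1 p.2 := by
            have := (Finset.mem_filter.1 hp).1
            simpa [hP] using this
          have hR' : R p'.1 p'.2 := by
            have := (Finset.mem_filter.1 hp').1
            simpa [hP] using this
          refine Prod.ext ?_ he.1
          exact huniq _ _ _ _ h2 (.inr h1) (.inr hR) (.inr (he.2 ▸ h1')) (.inr (he.1 ▸ hR'))
      refine hle.trans ?_
      rw [Finset.card_sigma]
      refine (Finset.sum_le_card_nsmul _ _ s fun y _ ↦ hfib (π y)).trans ?_
      simp [mul_comm]

/-- In a field, the orientation `u → v` iff `u.1 + 1 = v.1` and `u₂ + ν v₂ = u₁ v₁` gives a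
graph without four-cycles, as soon as the first coordinates `X`, `Y` never satisfy `X = ν Y`. -/
theorem eq_of_common_neighbors {F : Type*} [Field F] {S : Finset F} {ν : F} (hν : ν ≠ 0)
    (hS : ∀ X ∈ S, ∀ Y ∈ S, X ≠ ν * Y) (R : ZMod 3 × S × F → ZMod 3 × S × F → Prop)
    (hR : ∀ u v, R u v ↔ v.1 = u.1 + 1 ∧ u.2.2 + ν * v.2.2 = u.2.1 * v.2.1)
    (u v x y : ZMod 3 × S × F) (huv : u ≠ v) (hux : R u x ∨ R x u) (hvx : R v x ∨ R x v)
    (huy : R u y ∨ R y u) (hvy : R v y ∨ R y v) : x = y := by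
  obtain ⟨i, ⟨U, hU⟩, u⟩ := u
  obtain ⟨j, ⟨V, hV⟩, v⟩ := v
  obtain ⟨k, ⟨X, hX⟩, x⟩ := x
  obtain ⟨l, ⟨Y, hY⟩, y⟩ := y
  simp only [hR] at hux hvx huy hvy
  simp only [ne_eq, Prod.mk.injEq, Subtype.mk.injEq] at huv ⊢
  have cancel : ∀ {a b : F}, ν * a = ν * b → a = b := fun h ↦ mul_left_cancel₀ hν h
  have hXY := hS X hX Y hY
  have hYX := hS Y hY X hX
  have hUV := hS U hU V hV
  have hVU := hS V hV U hU
  have hidx : ∀ a : ZMod 3, a ≠ a + 1 ∧ a ≠ a + 1 + 1 ∧ a + 1 + 1 + 1 = a := by decide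
  have three : ∀ a b : ZMod 3, a + 1 = b + 1 → a = b := fun a b h ↦ add_right_cancel h
  rcases hux with ⟨rfl, e1⟩ | ⟨rfl, e1⟩
  · rcases hvx with ⟨h, e2⟩ | ⟨rfl, e2⟩
    · obtain rfl := three _ _ h
      have hne : U - V ≠ 0 := by
        intro h0
        obtain rfl := sub_eq_zero.1 h0
        exact huv ⟨rfl, rfl, by linear_combination e1 - e2⟩
      rcases huy with ⟨rfl, e3⟩ | ⟨rfl, e3⟩
      · rcases hvy with ⟨-, e4⟩ | ⟨h, -⟩
        · have : X = Y := mul_left_cancel₀ hne (by linear_combination e2 - e1 + e3 - e4)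
          subst this
          exact ⟨rfl, rfl, cancel (by linear_combination e1 - e3)⟩
        · exact absurd h (hidx _).2.1
      · rcases hvy with ⟨h, -⟩ | ⟨-, e4⟩
        · exact absurd h (hidx _).2.1
        · refine absurd ?_ hYX
          exact mul_left_cancel₀ hne (by linear_combination e4 - e3 + ν * (e1 - e2))
    · have hne : U - ν * V ≠ 0 := sub_ne_zero.2 hUV
      rcases huy with ⟨rfl, e3⟩ | ⟨rfl, e3⟩
      · rcases hvy with ⟨h, -⟩ | ⟨-, e4⟩
        · exact absurd (three _ _ h) (hidx _).2.1
        · have : X = Y := mul_left_cancel₀ hne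
            (by linear_combination -e1 + e3 + ν * (e2 - e4))
          subst this
          exact ⟨rfl, rfl, cancel (by linear_combination e1 - e3)⟩
      · rcases hvy with ⟨h, -⟩ | ⟨h, -⟩
        · exact absurd (h.trans (hidx _).2.2) (hidx _).1
        · exact absurd (three _ _ h).symm (hidx _).2.1
  · rcases hvx with ⟨rfl, e2⟩ | ⟨rfl, e2⟩
    · have hne : V - ν * U ≠ 0 := sub_ne_zero.2 hVU
      rcases huy with ⟨rfl, e3⟩ | ⟨h, e3⟩
      · rcases hvy with ⟨h, -⟩ | ⟨h, -⟩
        · exact absurd (three _ _ h).symm (hidx _).2.1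
        · exact absurd (h.trans (hidx _).2.2) (hidx _).1
      · obtain rfl := three _ _ h
        rcases hvy with ⟨-, e4⟩ | ⟨h, -⟩
        · have : X = Y := mul_left_cancel₀ hne
            (by linear_combination -e2 + e4 + ν * (e1 - e3))
          subst this
          exact ⟨rfl, rfl, by linear_combination e1 - e3⟩
        · exact absurd h (hidx _).2.1
    · have hne : U - V ≠ 0 := by
        intro h0
        obtain rfl := sub_eq_zero.1 h0
        exact huv ⟨rfl, rfl, cancel (by linear_combination e1 - e2)⟩
      rcases huy with ⟨rfl, e3⟩ | ⟨h, e3⟩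
      · rcases hvy with ⟨-, e4⟩ | ⟨h, -⟩
        · refine absurd ?_ hXY
          exact mul_left_cancel₀ hne (by linear_combination e2 - e1 + ν * (e3 - e4))
        · exact absurd (three _ _ h) (hidx _).2.1
      · obtain rfl := three _ _ h
        rcases hvy with ⟨h, -⟩ | ⟨-, e4⟩
        · exact absurd h (hidx _).2.1
        · have : X = Y := mul_left_cancel₀ hne (by linear_combination e2 - e1 + e3 - e4)
          subst this
          exact ⟨rfl, rfl, by linear_combination e1 - e3⟩

theorem exists_simpleGraph_of_field (F : Type*) [Field F] [Fintype F] {s m n : ℕ} (hs : s ≠ 0)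
    (hm : m ≠ 0) (hq : Fintype.card F = 2 * s * m + 1) (hn : 3 * (m * Fintype.card F) ≤ n) :
    ∃ G : SimpleGraph (Fin n), G.Colorable 3 ∧
      (∀ u v, u ≠ v → (G.commonNeighbors u v).ncard ≤ s) ∧
      3 * s * m * m * Fintype.card F ≤ G.edgeSet.ncard + 3 * s * m * Fintype.card F := by
  classical
  obtain ⟨g, hg⟩ : ∃ g : F, IsPrimitiveRoot g (2 * s * m) := by
    obtain ⟨g, hg⟩ := IsCyclic.exists_ofOrder_eq_natCard (α := Fˣ)
    refine ⟨g, ?_⟩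
    have : orderOf (g : F) = 2 * s * m := by
      rw [orderOf_units, hg, Nat.card_eq_fintype_card, Fintype.card_units, hq]
      simp
    exact this ▸ IsPrimitiveRoot.orderOf (g : F)
  have hpos : 0 < 2 * s * m := by positivity
  have hroots : ∀ a b : ℕ, 2 * s * m = a * b →
      (Polynomial.nthRootsFinset b (1 : F)).card = b := fun a b hab ↦
    (hg.pow hpos hab).card_nthRootsFinset
  have hS := hroots 2 (s * m) (by ring)
  have hB := hroots (2 * s) m (by ring)
  have hH := hroots (2 * m) s (by ring)
  set S := Polynomial.nthRootsFinset (s * m) (1 : F) with hSdef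
  set B := Polynomial.nthRootsFinset m (1 : F) with hBdef
  have hsm : 0 < s * m := by positivity
  have memS : ∀ X, X ∈ S ↔ X ^ (s * m) = 1 := fun X ↦ Polynomial.mem_nthRootsFinset hsm 1
  have memB : ∀ X, X ∈ B ↔ X ^ m = 1 := fun X ↦ Polynomial.mem_nthRootsFinset (by positivity) 1
  have hg0 : g ≠ 0 := hg.ne_zero hpos.ne'
  have hg1 : g ^ (s * m) ≠ 1 := hg.pow_ne_one_of_pos_of_lt hsm.ne' (by nlinarith)
  have hS0 : ∀ X ∈ S, X ≠ 0 := by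
    rintro X hX rfl
    rw [memS, zero_pow hsm.ne'] at hX
    exact zero_ne_one hX
  have hSν : ∀ X ∈ S, ∀ Y ∈ S, X ≠ g * Y := by
    rintro X hX Y hY rfl
    rw [memS] at hX hY
    rw [mul_pow, hY, mul_one] at hX
    exact hg1 hX
  let R : ZMod 3 × S × F → ZMod 3 × S × F → Prop := fun u v ↦
    v.1 = u.1 + 1 ∧ u.2.2 + g * v.2.2 = u.2.1 * v.2.1
  obtain ⟨ι⟩ : Nonempty (ZMod 3 × B × F ↪ Fin n) := by
    refine Function.Embedding.nonempty_of_card_le ?_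
    simpa [hB] using hn
  let π₀ : ZMod 3 × S × F → ZMod 3 × B × F := fun u ↦
    (u.1, ⟨(u.2.1 : F) ^ s, by
      rw [memB, ← pow_mul]
      exact (memS _).1 u.2.1.2⟩, u.2.2 / (u.2.1 : F) ^ 2)
  have hπ₀ : ∀ u v, π₀ u = π₀ v ↔ u.1 = v.1 ∧ (u.2.1 : F) ^ s = (v.2.1 : F) ^ s ∧
      u.2.2 / (u.2.1 : F) ^ 2 = v.2.2 / (v.2.1 : F) ^ 2 := by
    intro u v
    simp [π₀, Prod.ext_iff]
  have hπ : ∀ u v, ι (π₀ u) = ι (π₀ v) ↔ u.1 = v.1 ∧ (u.2.1 : F) ^ s = (v.2.1 : F) ^ s ∧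
      u.2.2 / (u.2.1 : F) ^ 2 = v.2.2 / (v.2.1 : F) ^ 2 := fun u v ↦
    (ι.injective.eq_iff).trans (hπ₀ u v)
  obtain ⟨G, hG1, hG2, hG3⟩ := exists_simpleGraph_of_cover (n := n) (s := s) R Prod.fst
    (fun u v h ↦ h.1) (eq_of_common_neighbors hg0 hSν R fun _ _ ↦ Iff.rfl) (ι ∘ π₀)
    (fun u v h ↦ ((hπ u v).1 h).1)
    (by
      rintro ⟨i, ⟨X, hX⟩, x⟩ ⟨j, ⟨Y, hY⟩, y⟩ ⟨i', ⟨X', hX'⟩, x'⟩ h he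
      obtain ⟨h1, h2, h3⟩ := (hπ _ _).1 he
      simp only at h1 h2 h3
      have hX0 := hS0 X hX
      have hX0' := hS0 X' hX'
      have hY0 := hS0 Y hY
      subst h1
      have hα : X' / X * Y ∈ S := by
        rw [memS] at hX hX' hY ⊢
        rw [mul_pow, div_pow, hX, hX', hY]
        simp
      have hx' : x' = (X' / X) ^ 2 * x := by
        field_simp at h3 ⊢
        linear_combination h3
      refine ⟨(j, ⟨X' / X * Y, hα⟩, (X' / X) ^ 2 * y), (hπ _ _).2 ⟨rfl, ?_, ?_⟩, ?_⟩
      · simp only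
        rw [mul_pow, div_pow, h2, div_self (pow_ne_zero _ hX0), one_mul]
      · simp only
        field_simp
      · simp only [R] at h ⊢
        refine h.imp (fun h ↦ ⟨h.1, ?_⟩) fun h ↦ ⟨h.1, ?_⟩
        · rw [hx']
          have : X' = X' / X * X := by field_simp
          linear_combination (X' / X) ^ 2 * h.2 - X' / X * Y * this
        · rw [hx']
          have : X' = X' / X * X := by field_simp
          linear_combination (X' / X) ^ 2 * h.2 - X' / X * Y * this)
    (by
      intro a
      rcases Finset.eq_empty_or_nonempty
        (Finset.univ.filter fun x ↦ (ι ∘ π₀) x = a) with h0 | ⟨v₀, hv₀⟩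
      · rw [h0]; simp
      rw [← hH]
      have hfib : ∀ v ∈ Finset.univ.filter fun x ↦ (ι ∘ π₀) x = a,
          v.1 = v₀.1 ∧ (v.2.1 : F) ^ s = (v₀.2.1 : F) ^ s ∧
          v.2.2 / (v.2.1 : F) ^ 2 = v₀.2.2 / (v₀.2.1 : F) ^ 2 := by
        intro v hv
        rw [Finset.mem_filter] at hv hv₀
        exact (hπ _ _).1 (hv.2.trans hv₀.2.symm)
      have hv0 := hS0 _ v₀.2.1.2
      refine Finset.card_le_card_of_injOn (fun v ↦ (v.2.1 : F) / v₀.2.1) ?_ ?_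
      · intro v hv
        rw [Finset.mem_coe, Polynomial.mem_nthRootsFinset (by positivity), div_pow, (hfib v hv).2.1,
          div_self (pow_ne_zero _ hv0)]
      · intro v hv w hw he
        obtain ⟨h1, -, h2⟩ := hfib v hv
        obtain ⟨h1', -, h2'⟩ := hfib w hw
        have hX : (v.2.1 : F) = w.2.1 := by
          simpa [div_left_inj' hv0] using he
        have hw0 := hS0 _ w.2.1.2
        refine Prod.ext (h1.trans h1'.symm) (Prod.ext (Subtype.ext hX) ?_)
        have := h2.trans h2'.symm
        rwa [hX, div_left_inj' (pow_ne_zero _ hw0)] at this)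
  refine ⟨G, hG1, hG2, ?_⟩
  have hcard : (3 * (s * m * Fintype.card F)) * (s * m) ≤
      (Finset.univ.filter fun p : (ZMod 3 × S × F) × (ZMod 3 × S × F) ↦ R p.1 p.2).card := by
    have : (3 * (s * m * Fintype.card F)) * (s * m) =
        (Finset.univ : Finset ((ZMod 3 × S × F) × S)).card := by simp [hS]
    rw [this]
    refine Finset.card_le_card_of_injOn
      (fun p ↦ (p.1, (p.1.1 + 1, p.2, (p.1.2.1 * p.2 - p.1.2.2) / g))) ?_ ?_
    · intro p _
      simp only [Finset.coe_filter, Finset.mem_univ, true_and, Set.mem_ofPred_eq, R]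
      field_simp
      ring
    · intro p _ p' _ h
      simp only [Prod.mk.injEq] at h
      exact Prod.ext h.1 h.2.2.1
  have hV : Fintype.card (ZMod 3 × S × F) = 3 * (s * m * Fintype.card F) := by simp [hS]
  rw [hV] at hG3
  refine Nat.le_of_mul_le_mul_left (c := s) ?_ (Nat.pos_of_ne_zero hs)
  linarith [hcard.trans hG3]

/-- For every modulus `N` there is a choice of prime powers `Q y ≡ 1` mod `N` with `Q y ≤ y` and
`Q y ~ y`. -/
theorem exists_primePow_selector (N : ℕ) [NeZero N] :
    ∃ Q : ℝ → ℕ, (∀ᶠ y in atTop, IsPrimePow (Q y) ∧ (Q y : ZMod N) = 1 ∧ (Q y : ℝ) ≤ y) ∧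
      Tendsto (fun y ↦ (Q y : ℝ) / y) atTop (𝓝 1) := by
  classical
  let P : ℕ → Prop := fun n ↦ IsPrimePow n ∧ (n : ZMod N) = 1
  have key : ∀ η : ℝ, 0 < η → ∀ᶠ y : ℝ in atTop,
      ∃ n : ℕ, P n ∧ (n : ℝ) ≤ y ∧ y * Real.exp (-(2 * η)) ≤ n := by
    intro η hη
    have hlog : Tendsto (fun y : ℝ ↦ Real.log y - η) atTop atTop :=
      tendsto_atTop_add_const_right _ _ Real.tendsto_log_atTop
    filter_upwards [hlog.eventually (eventually_exists_isPrimePow_abs_log_sub_lt N hη),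
      eventually_gt_atTop 0] with y ⟨n, hn, hn1, hlt⟩ hy
    have hn0 : (0 : ℝ) < n := by exact_mod_cast hn.pos
    rw [abs_lt] at hlt
    refine ⟨n, ⟨hn, hn1⟩, (Real.log_le_log_iff hn0 hy).1 (by linarith), ?_⟩
    rw [← Real.log_le_log_iff (by positivity) hn0, Real.log_mul hy.ne' (Real.exp_pos _).ne',
      Real.log_exp]
    linarith
  refine ⟨fun y ↦ Nat.findGreatest P ⌊y⌋₊, ?_, ?_⟩
  · filter_upwards [key 1 one_pos, eventually_ge_atTop 0] with y ⟨n, hn, hny, _⟩ hy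
    have hP : P (Nat.findGreatest P ⌊y⌋₊) := Nat.findGreatest_spec (Nat.le_floor hny) hn
    exact ⟨hP.1, hP.2, (Nat.cast_le.2 (Nat.findGreatest_le _)).trans (Nat.floor_le hy)⟩
  · rw [Metric.tendsto_nhds]
    intro ε hε
    have hcont : Tendsto (fun η : ℝ ↦ Real.exp (-(2 * η))) (𝓝[>] 0) (𝓝 1) := by
      have : Continuous fun η : ℝ ↦ Real.exp (-(2 * η)) := by fun_prop
      simpa using (this.tendsto 0).mono_left nhdsWithin_le_nhds
    obtain ⟨η, hη1, hη⟩ :=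
      ((hcont.eventually (lt_mem_nhds (by linarith : 1 - ε < 1))).and self_mem_nhdsWithin).exists
    filter_upwards [key η hη, eventually_gt_atTop 0] with y ⟨n, hn, hny, hyn⟩ hy
    have h1 : (n : ℝ) ≤ Nat.findGreatest P ⌊y⌋₊ :=
      Nat.cast_le.2 (Nat.le_findGreatest (Nat.le_floor hny) hn)
    have h2 : (Nat.findGreatest P ⌊y⌋₊ : ℝ) ≤ y :=
      (Nat.cast_le.2 (Nat.findGreatest_le _)).trans (Nat.floor_le hy.le)
    have h3 : Real.exp (-(2 * η)) ≤ (Nat.findGreatest P ⌊y⌋₊ : ℝ) / y := by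
      rw [le_div_iff₀ hy]
      linarith
    have h4 : (Nat.findGreatest P ⌊y⌋₊ : ℝ) / y ≤ 1 := (div_le_one hy).2 h2
    rw [Real.dist_eq, abs_lt]
    constructor <;> linarith

/-- The number of pairs formed by a vertex of `S` and one of its neighbours, in a graph with
codegrees at most `s`, when all neighbours of `S` lie in `T`. -/
theorem sum_degree_le_of_codegree_le {V : Type*} [Fintype V] [DecidableEq V] (G : SimpleGraph V)
    [DecidableRel G.Adj] {s : ℕ} (hG : ∀ u v, u ≠ v → (G.commonNeighbors u v).ncard ≤ s)
    {S T : Finset V} (hST : ∀ v, ∀ a ∈ S, G.Adj v a → v ∈ T) :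
    (∑ a ∈ S, (G.degree a : ℝ)) ≤ T.card + S.card * √(s * T.card) := by
  let A : V → V → ℝ := fun v a ↦ if G.Adj v a then 1 else 0
  have hdeg : ∀ a, (G.degree a : ℝ) = ∑ v ∈ T, A v a + ∑ v ∈ Tᶜ, A v a := by
    intro a
    rw [Finset.sum_add_sum_compl, ← G.card_neighborFinset_eq_degree,
      G.neighborFinset_eq_filter, Finset.card_filter]
    simp [A, G.adj_comm a]
  have hE : (∑ a ∈ S, (G.degree a : ℝ)) = ∑ v ∈ T, ∑ a ∈ S, A v a := by
    rw [Finset.sum_comm]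
    refine Finset.sum_congr rfl fun a ha ↦ ?_
    rw [hdeg, add_eq_left]
    refine Finset.sum_eq_zero fun v hv ↦ if_neg fun h ↦ ?_
    exact Finset.mem_compl.1 hv (hST v a ha h)
  have hcod : ∀ a ∈ S, ∀ b ∈ S, ∑ v ∈ T, A v a * A v b ≤
      s + if a = b then (G.degree a : ℝ) else 0 := by
    intro a _ b _
    split_ifs with hab
    · subst hab
      rw [hdeg]
      have h0 : 0 ≤ ∑ v ∈ Tᶜ, A v a := Finset.sum_nonneg fun v _ ↦ by positivity
      have h1 : ∑ v ∈ T, A v a * A v a = ∑ v ∈ T, A v a :=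
        Finset.sum_congr rfl fun v _ ↦ by by_cases h : G.Adj v a <;> simp [A, h]
      have : (0 : ℝ) ≤ s := Nat.cast_nonneg s
      linarith
    · have h1 : ∑ v ∈ T, A v a * A v b ≤ ∑ v, A v a * A v b :=
        Finset.sum_le_sum_of_subset_of_nonneg (Finset.subset_univ _) fun v _ _ ↦ by positivity
      have h2 : ∑ v, A v a * A v b = (G.commonNeighbors a b).ncard := by
        have hset : G.commonNeighbors a b =
            ↑(Finset.univ.filter fun v ↦ G.Adj v a ∧ G.Adj v b) := by
          ext v
          simp [SimpleGraph.mem_commonNeighbors, G.adj_comm a, G.adj_comm b]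
        rw [hset, Set.ncard_coe_finset, Finset.card_filter, Nat.cast_sum]
        refine Finset.sum_congr rfl fun v _ ↦ ?_
        by_cases ha : G.Adj v a <;> by_cases hb : G.Adj v b <;> simp [A, ha, hb]
      rw [add_zero]
      exact h1.trans (h2.le.trans (Nat.cast_le.2 (hG a b hab)))
  set E : ℝ := ∑ a ∈ S, (G.degree a : ℝ) with hEdef
  have hsq : ∑ v ∈ T, (∑ a ∈ S, A v a) ^ 2 ≤ s * (S.card : ℝ) ^ 2 + E := by
    calc ∑ v ∈ T, (∑ a ∈ S, A v a) ^ 2 = ∑ v ∈ T, ∑ a ∈ S, ∑ b ∈ S, A v a * A v b := by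
          simp_rw [sq, Finset.sum_mul_sum]
      _ = ∑ a ∈ S, ∑ b ∈ S, ∑ v ∈ T, A v a * A v b := by
          rw [Finset.sum_comm]
          exact Finset.sum_congr rfl fun a _ ↦ Finset.sum_comm
      _ ≤ ∑ a ∈ S, ∑ b ∈ S, (s + if a = b then (G.degree a : ℝ) else 0) :=
          Finset.sum_le_sum fun a ha ↦ Finset.sum_le_sum fun b hb ↦ hcod a ha b hb
      _ = s * (S.card : ℝ) ^ 2 + E := by
          simp only [Finset.sum_add_distrib, Finset.sum_const, nsmul_eq_mul, Finset.sum_ite_eq]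
          rw [Finset.sum_congr rfl fun a ha ↦ if_pos ha]
          ring
  have hcs : E ^ 2 ≤ T.card * (s * (S.card : ℝ) ^ 2 + E) := by
    rw [hE]
    refine sq_sum_le_card_mul_sum_sq.trans ?_
    rw [← hE]
    gcongr
  have hr : (S.card * √(s * T.card)) ^ 2 = T.card * (s * (S.card : ℝ) ^ 2) := by
    rw [mul_pow, Real.sq_sqrt (by positivity)]
    ring
  have hr0 : 0 ≤ S.card * √(s * T.card) := by positivity
  have hT : (0 : ℝ) ≤ T.card := Nat.cast_nonneg _
  by_contra! hlt
  nlinarith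

/-- A `3`-colorable graph with codegrees at most `s` has at most `√(s/6) n^{3/2} + n` edges. -/
theorem ncard_edgeSet_le_of_colorable_three {n s : ℕ} (G : SimpleGraph (Fin n))
    (hc : G.Colorable 3) (hG : ∀ u v, u ≠ v → (G.commonNeighbors u v).ncard ≤ s) :
    (G.edgeSet.ncard : ℝ) ≤ √((s : ℝ) / 6) * (n : ℝ) ^ (3 / 2 : ℝ) + n := by
  classical
  obtain ⟨c⟩ := hc
  let S : Fin 3 → Finset (Fin n) := fun i ↦ Finset.univ.filter fun v ↦ c v = i
  let k : Fin 3 → ℝ := fun i ↦ (S i).card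
  have hk : ∑ i, k i = n := by
    have := Finset.card_eq_sum_card_fiberwise (f := c) (s := Finset.univ) (t := Finset.univ)
      fun v _ ↦ Finset.mem_coe.2 (Finset.mem_univ _)
    simp only [Finset.card_univ, Fintype.card_fin] at this
    simp only [k, S]
    exact_mod_cast this.symm
  have hk0 : ∀ i, 0 ≤ k i := fun i ↦ Nat.cast_nonneg _
  have hkn : ∀ i, 0 ≤ n - k i := fun i ↦ by
    rw [← hk, sub_nonneg]
    exact Finset.single_le_sum (fun j _ ↦ hk0 j) (Finset.mem_univ i)
  have hcompl : ∀ i, ((S i)ᶜ.card : ℝ) = n - k i := fun i ↦ by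
    rw [Finset.card_compl, Nat.cast_sub (Finset.card_le_univ _), Fintype.card_fin]
  have hpart : ∀ i, (∑ a ∈ S i, (G.degree a : ℝ)) ≤ (n - k i) + √s * (k i * √(n - k i)) := by
    intro i
    have := sum_degree_le_of_codegree_le G hG (S := S i) (T := (S i)ᶜ) fun v a ha hva ↦ by
      simp only [S, Finset.mem_filter, Finset.mem_univ, true_and, Finset.mem_compl] at ha ⊢
      exact fun h ↦ c.valid hva (h.trans ha.symm)
    rw [hcompl, Real.sqrt_mul (Nat.cast_nonneg s)] at this
    refine this.trans (le_of_eq ?_)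
    simp only [k]
    ring
  have htot : 2 * (G.edgeSet.ncard : ℝ) = ∑ i, ∑ a ∈ S i, (G.degree a : ℝ) := by
    rw [Finset.sum_fiberwise, ← Nat.cast_sum, G.sum_degrees_eq_twice_card_edges,
      Set.ncard_eq_toFinset_card']
    push_cast
    rfl
  have hcs : (∑ i, k i * √(n - k i)) ^ 2 ≤ n * (n * n - n * n / 3) := by
    refine (Finset.sum_sq_le_sum_mul_sum_of_sq_le_mul Finset.univ (f := k)
      (g := fun i ↦ k i * (n - k i)) (fun i _ ↦ hk0 i)
      (fun i _ ↦ mul_nonneg (hk0 i) (hkn i)) fun i _ ↦ ?_).trans ?_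
    · rw [mul_pow, Real.sq_sqrt (hkn i)]
      exact le_of_eq (by ring)
    · rw [hk]
      refine mul_le_mul_of_nonneg_left ?_ (Nat.cast_nonneg n)
      rw [Fin.sum_univ_three] at hk ⊢
      rw [← hk]
      nlinarith [sq_nonneg (k 0 - k 1), sq_nonneg (k 0 - k 2), sq_nonneg (k 1 - k 2)]
  have hsum : 2 * (G.edgeSet.ncard : ℝ) ≤ 2 * n + √s * ∑ i, k i * √(n - k i) := by
    rw [htot]
    refine (Finset.sum_le_sum fun i _ ↦ hpart i).trans (le_of_eq ?_)
    rw [Finset.sum_add_distrib, Finset.sum_sub_distrib, hk, Finset.mul_sum]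
    simp
    ring
  have hpow : ((n : ℝ) ^ (3 / 2 : ℝ)) ^ 2 = n ^ 3 := by
    rw [← Real.rpow_natCast, ← Real.rpow_mul (Nat.cast_nonneg n), ← Real.rpow_natCast]
    norm_num
  have hmain : √s * ∑ i, k i * √(n - k i) ≤ 2 * (√((s : ℝ) / 6) * (n : ℝ) ^ (3 / 2 : ℝ)) := by
    refine le_of_sq_le_sq ?_ (by positivity)
    rw [mul_pow, mul_pow, mul_pow, hpow, Real.sq_sqrt (Nat.cast_nonneg s),
      Real.sq_sqrt (by positivity)]
    refine (mul_le_mul_of_nonneg_left hcs (Nat.cast_nonneg s)).trans (le_of_eq ?_)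
    ring
  linarith

/-- Every `3`-colorable graph with codegrees at most `t - 1` has at most `exChi3 t n` edges. -/
theorem ncard_edgeSet_le_exChi3 {t n : ℕ} (G : SimpleGraph (Fin n)) (hc : G.Colorable 3)
    (hG : ∀ u v, u ≠ v → (G.commonNeighbors u v).ncard ≤ t - 1) :
    G.edgeSet.ncard ≤ exChi3 t n := by
  refine le_csSup ⟨(Set.univ : Set (Sym2 (Fin n))).ncard, ?_⟩ ⟨G, hc, hG, rfl⟩
  rintro _ ⟨H, -, -, rfl⟩
  exact Set.ncard_le_ncard (Set.subset_univ _) (Set.toFinite _)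

theorem exChi3_le (t n : ℕ) :
    (exChi3 t n : ℝ) ≤ √(((t - 1 : ℕ) : ℝ) / 6) * (n : ℝ) ^ (3 / 2 : ℝ) + n := by
  have hmem : exChi3 t n ∈ {m | ∃ G : SimpleGraph (Fin n), G.Colorable 3 ∧
      (∀ u v, u ≠ v → (G.commonNeighbors u v).ncard ≤ t - 1) ∧ G.edgeSet.ncard = m} := by
    refine Nat.sSup_mem ⟨_, ⊥, ?_, ?_, rfl⟩ ⟨(Set.univ : Set (Sym2 (Fin n))).ncard, ?_⟩
    · exact ⟨SimpleGraph.Coloring.mk (fun _ ↦ 0) fun h ↦ h.elim⟩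
    · intro u v _
      have : (⊥ : SimpleGraph (Fin n)).commonNeighbors u v = ∅ := by
        ext w
        simp
      simp [this]
    · rintro _ ⟨H, -, -, rfl⟩
      exact Set.ncard_le_ncard (Set.subset_univ _) (Set.toFinite _)
  obtain ⟨G, hc, hG, he⟩ := hmem
  rw [← he]
  exact ncard_edgeSet_le_of_colorable_three G hc hG

/-- A prime power `q ≡ 1` mod `2 (t - 1)` with `q² ≤ 2 (t - 1) n / 3` gives a lower bound for
`exChi3 t n`. -/
theorem le_exChi3_of_isPrimePow {t n q : ℕ} (ht : 2 ≤ t) (hq : IsPrimePow q)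
    (hq1 : (q : ZMod (2 * (t - 1))) = 1) (hqn : 3 * q ^ 2 ≤ 2 * (t - 1) * n) :
    3 / (4 * ((t : ℝ) - 1)) * (q * (q - 1) ^ 2) - 3 / 2 * (q * (q - 1)) ≤ exChi3 t n := by
  obtain ⟨s, rfl⟩ : ∃ s, t = s + 1 := ⟨t - 1, by omega⟩
  have hs : s ≠ 0 := by omega
  rw [Nat.add_sub_cancel] at hq1 hqn
  obtain ⟨m, hm⟩ : 2 * s ∣ q - 1 := by
    rw [← ZMod.natCast_eq_zero_iff, Nat.cast_sub hq.pos, hq1, Nat.cast_one, sub_self]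
  have hq2 := hq.one_lt
  have hqm : q = 2 * s * m + 1 := by omega
  have hm0 : m ≠ 0 := by
    rintro rfl
    omega
  obtain ⟨p, k, hp, hk, hpk⟩ := hq
  have : Fact p.Prime := ⟨hp.nat_prime⟩
  have : Fintype (GaloisField p k) := Fintype.ofFinite _
  have hcard : Fintype.card (GaloisField p k) = q := by
    rw [← hpk, ← Nat.card_eq_fintype_card, GaloisField.card p k hk.ne']
  obtain ⟨G, hc, hG, hE⟩ := exists_simpleGraph_of_field (GaloisField p k) (n := n) hs hm0
    (hcard.trans hqm) <| by
      rw [hcard]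
      refine le_of_mul_le_mul_left (a := 2 * s) ?_ (by positivity)
      calc 2 * s * (3 * (m * q)) = 3 * (2 * s * m * q) := by ring
        _ ≤ 3 * q ^ 2 := by
            rw [sq]
            gcongr
            omega
        _ ≤ 2 * s * n := hqn
  rw [hcard] at hE
  have hle := hE.trans (Nat.add_le_add_right (ncard_edgeSet_le_exChi3 (t := s + 1) G hc hG) _)
  have hle' : (3 * s * m * m * q : ℝ) ≤ exChi3 (s + 1) n + 3 * s * m * q := by exact_mod_cast hle
  have hqR : (q : ℝ) = 2 * s * m + 1 := by exact_mod_cast hqm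
  have hs' : (s : ℝ) ≠ 0 := by exact_mod_cast hs
  have e1 : 3 / (4 * (((s + 1 : ℕ) : ℝ) - 1)) * (q * (q - 1) ^ 2) = 3 * s * m * m * q := by
    have : (q : ℝ) - 1 = 2 * s * m := by linarith
    rw [this]
    push_cast
    rw [add_sub_cancel_right]
    field_simp
    ring
  have e2 : 3 / 2 * (q * (q - 1) : ℝ) = 3 * s * m * q := by
    have : (q : ℝ) - 1 = 2 * s * m := by linarith
    rw [this]
    ring
  rw [e1, e2]
  linarith

/-- The normalised lower bound coming from the prime powers `Q y ~ y`. -/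
theorem tendsto_lower_bound {a : ℝ} (ha : 0 < a) {Q : ℝ → ℕ}
    (hQ : Tendsto (fun y ↦ (Q y : ℝ) / y) atTop (𝓝 1)) :
    Tendsto
      (fun y : ℝ ↦ (3 / (4 * a) * (Q y * (Q y - 1) ^ 2) - 3 / 2 * (Q y * (Q y - 1))) / y ^ 3)
      atTop (𝓝 (3 / (4 * a))) := by
  have hinv : Tendsto (fun y : ℝ ↦ y⁻¹) atTop (𝓝 0) := tendsto_inv_atTop_zero
  have h1 := hQ.sub hinv
  have h := ((hQ.mul (h1.pow 2)).const_mul (3 / (4 * a))).sub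
    (((hQ.mul h1).mul hinv).const_mul (3 / 2))
  have hlim : 3 / (4 * a) * (1 * (1 - 0) ^ 2) - 3 / 2 * (1 * (1 - 0) * 0) = 3 / (4 * a) := by ring
  rw [hlim] at h
  refine h.congr' ?_
  filter_upwards [eventually_gt_atTop 0] with y hy
  field_simp

theorem rpow_three_halves_eq {x : ℝ} (hx : 0 ≤ x) : x ^ (3 / 2 : ℝ) = √x ^ 3 := by
  rw [Real.sqrt_eq_rpow, ← Real.rpow_natCast, ← Real.rpow_mul hx]
  norm_num

/-- **Main theorem.** For every integer `t ≥ 2`,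
`ex_{χ≤3}(n, K_{2,t}) = √((t-1)/6) · n^{3/2} + o(n^{3/2})`, i.e.
`lim_{n→∞} ex_{χ≤3}(n, K_{2,t}) / n^{3/2} = √((t-1)/6)`. -/
theorem stmt_14 (t : ℕ) (ht : 2 ≤ t) :
    Filter.Tendsto (fun n : ℕ => (exChi3 t n : ℝ) / (n : ℝ) ^ (3 / 2 : ℝ))
      Filter.atTop (nhds (Real.sqrt (((t : ℝ) - 1) / 6))) := by
  have hcast : ((t - 1 : ℕ) : ℝ) = t - 1 := by
    rw [Nat.cast_sub (by omega), Nat.cast_one]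
  have hs : (0 : ℝ) < t - 1 := by
    rw [← hcast]
    exact_mod_cast (by omega : 0 < t - 1)
  have : NeZero (2 * (t - 1)) := ⟨by omega⟩
  obtain ⟨Q, hQ, hQlim⟩ := exists_primePow_selector (2 * (t - 1))
  set c : ℝ := √(2 * (t - 1) / 3) with hc
  have hc0 : 0 < c := Real.sqrt_pos.2 (by positivity)
  have hc2 : c ^ 2 = 2 * (t - 1) / 3 := Real.sq_sqrt (by positivity)
  have hsqrt : Tendsto (fun n : ℕ ↦ √(n : ℝ)) atTop atTop :=
    Real.tendsto_sqrt_atTop.comp tendsto_natCast_atTop_atTop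
  have hY : Tendsto (fun n : ℕ ↦ c * √(n : ℝ)) atTop atTop := hsqrt.const_mul_atTop hc0
  have hval : c ^ 3 * (3 / (4 * ((t : ℝ) - 1))) = √(((t : ℝ) - 1) / 6) := by
    have hc6 : (c ^ 3) ^ 2 = (2 * (t - 1) / 3) ^ 3 := by
      rw [← hc2]
      ring
    rw [eq_comm, Real.sqrt_eq_iff_eq_sq (by positivity) (by positivity), mul_pow, hc6]
    field_simp
    norm_num
  have hlow := ((tendsto_lower_bound hs hQlim).comp hY).const_mul (c ^ 3)
  rw [hval] at hlow
  have hupp : Tendsto (fun n : ℕ ↦ √(((t : ℝ) - 1) / 6) + (√(n : ℝ))⁻¹) atTop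
      (𝓝 (√(((t : ℝ) - 1) / 6))) := by
    simpa using (tendsto_const_nhds (x := √(((t : ℝ) - 1) / 6))).add
      (tendsto_inv_atTop_zero.comp hsqrt)
  refine tendsto_of_tendsto_of_tendsto_of_le_of_le' hlow hupp ?_ ?_
  · filter_upwards [hY.eventually hQ, eventually_gt_atTop 0] with n ⟨hq, hq1, hqY⟩ hn
    have hn' : (0 : ℝ) < n := by exact_mod_cast hn
    have hsq := pow_le_pow_left₀ (Nat.cast_nonneg _) hqY 2
    rw [mul_pow, hc2, Real.sq_sqrt hn'.le] at hsq
    have hqn : 3 * Q (c * √n) ^ 2 ≤ 2 * (t - 1) * n := by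
      have : (3 * (Q (c * √n) : ℝ) ^ 2) ≤ 2 * ((t - 1 : ℕ) : ℝ) * n := by
        rw [hcast]
        linarith
      exact_mod_cast this
    have hle := le_exChi3_of_isPrimePow ht hq hq1 hqn
    rw [rpow_three_halves_eq hn'.le, Function.comp_apply, mul_pow, ← mul_div_assoc,
      mul_div_mul_left _ _ (by positivity)]
    gcongr
  · filter_upwards [eventually_gt_atTop 0] with n hn
    have hn' : (0 : ℝ) < n := by exact_mod_cast hn
    have hr := Real.sqrt_pos.2 hn'
    have hle := exChi3_le t n
    rw [rpow_three_halves_eq hn'.le, hcast] at hle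
    rw [rpow_three_halves_eq hn'.le, div_le_iff₀ (by positivity)]
    refine hle.trans (le_of_eq ?_)
    have : √(n : ℝ) ^ 3 = √(n : ℝ) * n := by
      rw [pow_succ', Real.sq_sqrt hn'.le]
    rw [add_mul, this, inv_mul_cancel_left₀ hr.ne']
end

section
/- Let $t \ge 2$ be an even integer and $p$ a prime with $p - 1 = a(t-1)$ and $a$ even, let $g$ be a primitive root of $\mathbb{F}_p$, and let $B = \{g, g^2, \dots, g^{a/2}\}$, $W = \{a, 2a, \dots, (t-1)a\}$. Then for all $(w_1, b_1), (w_2, b_2) \in W \times B$, the sum $g^{-w_1} b_1 + g^{-w_2} b_2$ is nonzero in $\mathbb{F}_p$. -/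
/-- **no vanishing sums.** Let `t ≥ 2` be even, `p` prime with
`p - 1 = a(t-1)` and `a` even, `g` a primitive root of `𝔽_p`, `B = {g, g², …, g^{a/2}}`,
`W = {a, 2a, …, (t-1)a}`. Then for all `(w₁,b₁), (w₂,b₂) ∈ W × B`, the sum
`g^{-w₁} b₁ + g^{-w₂} b₂` is nonzero in `𝔽_p`. -/
theorem stmt_18 (t a p : ℕ) (ht : 2 ≤ t) (hteven : Even t) (hp : p.Prime)
    (hpa : p - 1 = a * (t - 1)) (ha : Even a)
    (g : ZMod p) (hg : IsPrimitiveRoot g (p - 1))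
    (W : Set ℕ) (hW : W = {w | ∃ j, 1 ≤ j ∧ j ≤ t - 1 ∧ w = j * a})
    (B : Set (ZMod p)) (hB : B = {b | ∃ i, 1 ≤ i ∧ i ≤ a / 2 ∧ b = g ^ i}) :
    ∀ w₁ b₁ w₂ b₂, w₁ ∈ W → b₁ ∈ B → w₂ ∈ W → b₂ ∈ B →
      (g ^ w₁)⁻¹ * b₁ + (g ^ w₂)⁻¹ * b₂ ≠ 0 := by
  have : Fact p.Prime := ⟨hp⟩
  rintro w₁ b₁ w₂ b₂ hw₁ hb₁ hw₂ hb₂ hsum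
  subst hW hB
  obtain ⟨j₁, -, -, rfl⟩ := hw₁
  obtain ⟨j₂, -, -, rfl⟩ := hw₂
  obtain ⟨i₁, hi₁, hi₁', rfl⟩ := hb₁
  obtain ⟨i₂, hi₂, hi₂', rfl⟩ := hb₂
  have hodd : Odd (t - 1) := by grind
  obtain ⟨c, rfl⟩ := ha
  have hc : 0 < c := by omega
  have hpos : 0 < p - 1 := by rw [hpa]; exact Nat.mul_pos (by omega) (by omega)
  have hcc : c + c ≤ p - 1 := by rw [hpa]; exact Nat.le_mul_of_pos_right _ (by omega)
  have : NeZero (2 : ZMod p) := ⟨Ring.two_ne_zero (by rw [ZMod.ringChar_zmod_n]; omega)⟩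
  have hg0 : g ≠ 0 := hg.ne_zero hpos.ne'
  have hone (j : ℕ) : ((g ^ (j * (c + c)))⁻¹) ^ (t - 1) = 1 := by
    rw [inv_pow, ← pow_mul, mul_assoc, ← hpa, mul_comm, pow_mul, hg.pow_eq_one, one_pow, inv_one]
  -- The `(t - 1)`-th power kills the factors `g ^ w` and preserves the sign.
  have hneg : (g ^ i₁) ^ (t - 1) = -(g ^ i₂) ^ (t - 1) := by
    have h := congrArg (· ^ (t - 1)) (eq_neg_of_add_eq_zero_left hsum)
    simpa only [hodd.neg_pow, mul_pow, hone, one_mul] using h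
  have hk : IsPrimitiveRoot (g ^ ((t - 1) * 2)) c := hg.pow hpos (by rw [hpa]; ring)
  have hsq : (g ^ ((t - 1) * 2)) ^ i₁ = (g ^ ((t - 1) * 2)) ^ i₂ := by
    have h := congrArg (· ^ 2) hneg
    simpa only [neg_sq, ← pow_mul, mul_comm, mul_left_comm, mul_assoc] using h
  have hi : i₁ = i₂ := by
    obtain ⟨m, rfl⟩ := Nat.exists_eq_add_of_le' hi₁
    obtain ⟨n, rfl⟩ := Nat.exists_eq_add_of_le' hi₂
    rw [pow_succ, pow_succ] at hsq
    rw [hk.pow_inj (by omega) (by omega) (mul_right_cancel₀ (pow_ne_zero _ hg0) hsq)]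
  subst hi
  have hx : (g ^ i₁) ^ (t - 1) ≠ 0 := pow_ne_zero _ (pow_ne_zero _ hg0)
  have h2 : 2 * (g ^ i₁) ^ (t - 1) = 0 := by linear_combination hneg
  exact (mul_ne_zero two_ne_zero hx) h2
end
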